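/- arXiv:2204.01727 — 2 statements merged into one kernel-verified Lean document; each statement's English description precedes it below -/
import Mathlib

section
/- Let p be a prime, let Γ, l be elements of ZMod p with Γ ≠ 0, and let f : ZMod p → ZMod p be an injective function with f(0) = 0. Suppose that for every natural number n ≥ 1 one has f(n·Γ) = f((n-1)·Γ) + f(Γ) + (n-1)·l in ZMod p. Then l = 0. -/
/-- Key arithmetic step in the proof of Lemma 3.6 (`isomorphismcyclic`):
if `f : ZMod p → ZMod p` is injective with `f 0 = 0`, `Γ ≠ 0`, and `f`
satisfies the recurrence `f(n·Γ) = f((n-1)·Γ) + f(Γ) + (n-1)·l` for all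
`n ≥ 1`, then the intersection number `l` must vanish. -/
theorem intersection_number_vanishes (p : ℕ) (hp : p.Prime)
    (Γ l : ZMod p) (hΓ : Γ ≠ 0) (f : ZMod p → ZMod p)
    (hinj : Function.Injective f) (hf0 : f 0 = 0)
    (hrec : ∀ n : ℕ, 1 ≤ n →
      f ((n : ZMod p) * Γ) =
        f (((n - 1 : ℕ) : ZMod p) * Γ) + f Γ + ((n - 1 : ℕ) : ZMod p) * l) :
    l = 0 := by
  haveI : Fact p.Prime := ⟨hp⟩
  by_contra hl
  have hm : (((-f Γ / l).val : ℕ) : ZMod p) = -f Γ / l := ZMod.natCast_zmod_val _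
  have h := hrec ((-f Γ / l).val + 1) (Nat.le_add_left 1 _)
  rw [Nat.add_sub_cancel, Nat.cast_add, Nat.cast_one, hm, div_mul_cancel₀ _ hl,
    add_neg_cancel_right] at h
  have h2 := hinj h
  rw [add_mul, one_mul] at h2
  exact hΓ (left_eq_add.mp h2.symm)
end

section
/- Let p be a prime, let Γ, l be elements of ZMod p with Γ ≠ 0, and let f : ZMod p → ZMod p be a bijective function with f(0) = 0. Suppose that for every natural number n ≥ 1 one has f(n·Γ) = f((n-1)·Γ) + f(Γ) + (n-1)·l in ZMod p. Then f is an additive group automorphism of ZMod p; that is, f(x + y) = f(x) + f(y) for all x, y in ZMod p (equivalently, f(x) = c·x for all x, where c = f(Γ)·Γ⁻¹ ≠ 0). -/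
/-- Conclusion of Lemma 3.6 (`isomorphismcyclic`): if `f : ZMod p → ZMod p`
is bijective with `f 0 = 0`, `Γ ≠ 0`, and `f` satisfies the recurrence
`f(n·Γ) = f((n-1)·Γ) + f(Γ) + (n-1)·l` for all `n ≥ 1`, then `f` is an
additive group automorphism, i.e. `f(x + y) = f x + f y` for all `x, y`. -/
theorem f_is_group_automorphism (p : ℕ) (hp : p.Prime)
    (Γ l : ZMod p) (hΓ : Γ ≠ 0) (f : ZMod p → ZMod p)
    (hbij : Function.Bijective f) (hf0 : f 0 = 0)
    (hrec : ∀ n : ℕ, 1 ≤ n →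
      f ((n : ZMod p) * Γ) =
        f (((n - 1 : ℕ) : ZMod p) * Γ) + f Γ + ((n - 1 : ℕ) : ZMod p) * l) :
    ∀ x y : ZMod p, f (x + y) = f x + f y := by
  haveI : Fact p.Prime := ⟨hp⟩
  have step : ∀ x : ZMod p, f ((x + 1) * Γ) = f (x * Γ) + f Γ + x * l := by
    intro x
    have h := hrec (x.val + 1) (by omega)
    simpa using h
  have hl : l = 0 := by
    by_contra hl
    have h := step (-(f Γ) / l)
    rw [div_mul_cancel₀ _ hl, add_neg_cancel_right] at h
    have h2 := mul_right_cancel₀ hΓ (hbij.1 h)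
    simp at h2
  have lin : ∀ n : ℕ, f ((n : ZMod p) * Γ) = n * f Γ := by
    intro n
    induction n with
    | zero => simpa using hf0
    | succ k ih =>
      have h := step k
      rw [ih, hl] at h
      push_cast
      rw [h]
      ring
  have lin2 : ∀ x : ZMod p, f (x * Γ) = x * f Γ := by
    intro x
    simpa using lin x.val
  intro x y
  have key : ∀ z : ZMod p, f z = z / Γ * f Γ := by
    intro z
    rw [← lin2, div_mul_cancel₀ _ hΓ]
  rw [key (x + y), key x, key y]
  ring
end
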